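/- Let R be a one-dimensional Cohen-Macaulay semi-local Arf ring and I an integrally closed ideal of R containing a nonzerodivisor. Then I = R : (R : I); in particular, I is a reflexive R-module. -/

import Mathlib

/-- `x` is integral over the ideal `I`: there are `n ≥ 1` and `a_i ∈ I^i` with
`x^n + a_1 x^{n-1} + ... + a_n = 0`. -/
def IsIntegralOverIdeal {R : Type*} [CommRing R] (I : Ideal R) (x : R) : Prop :=
  ∃ n : ℕ, 0 < n ∧ ∃ a : ℕ → R, (∀ i, 1 ≤ i → i ≤ n → a i ∈ I ^ i) ∧
    x ^ n + ∑ i ∈ Finset.Icc 1 n, a i * x ^ (n - i) = 0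

/-- An ideal is integrally closed if it contains every element integral over it. -/
def IsIntegrallyClosedIdeal {R : Type*} [CommRing R] (I : Ideal R) : Prop :=
  ∀ x : R, IsIntegralOverIdeal I x → x ∈ I

/-- A ring `R` is an Arf ring if for every integrally closed ideal `I` of `R` containing a
nonzerodivisor there exists `a ∈ I` with `I² = aI`. -/
def IsArfRing (R : Type*) [CommRing R] : Prop :=
  ∀ I : Ideal R, IsIntegrallyClosedIdeal I → (∃ x ∈ I, x ∈ nonZeroDivisors R) →
    ∃ a ∈ I, I ^ 2 = Ideal.span {a} * I

/-- A one-dimensional Cohen-Macaulay semi-local ring: a commutative Noetherian ring with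
finitely many maximal ideals, all of whose localizations at maximal ideals are Noetherian
local rings of Krull dimension one whose maximal ideal contains a nonzerodivisor. -/
def IsOneDimCMSemiLocal (R : Type*) [CommRing R] : Prop :=
  IsNoetherianRing R ∧ {I : Ideal R | I.IsMaximal}.Finite ∧
  ∀ m : Ideal R, (hm : m.IsMaximal) →
    letI := hm.isPrime
    ringKrullDim (Localization.AtPrime m) = 1 ∧
    ∃ x ∈ IsLocalRing.maximalIdeal (Localization.AtPrime m),
      x ∈ nonZeroDivisors (Localization.AtPrime m)

/-- The image of an ideal of `R` in the total ring of fractions `Q(R)`,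
as an `R`-submodule of `Q(R)`. -/
noncomputable def idealImage {R : Type*} [CommRing R] (I : Ideal R) :
    Submodule R (FractionRing R) :=
  Submodule.map (Algebra.linearMap R (FractionRing R)) I

open scoped nonZeroDivisors in
/-- If `I² = aI` with `a` a nonzerodivisor in `I`, every `α / a` with `α ∈ R : (R : I)` is almost
integral over `R`. -/
theorem isAlmostIntegral_mul_of_mem_one_div_one_div {R : Type*} [CommRing R] {I : Ideal R}
    {a : R} (haI : a ∈ I) (ha : a ∈ R⁰) (hI : I ^ 2 = Ideal.span {a} * I)
    {b α : FractionRing R} (hb : algebraMap R (FractionRing R) a * b = 1)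
    (hα : α ∈ 1 / (1 / idealImage I)) : IsAlmostIntegral R (α * b) := by
  have step : ∀ y ∈ 1 / idealImage I, α * b * y ∈ 1 / idealImage I := by
    rintro y hy _ ⟨i, hi, rfl⟩
    have hyi : y * b * algebraMap R (FractionRing R) i ∈ 1 / idealImage I := by
      rintro _ ⟨j, hj, rfl⟩
      have hij : i * j ∈ Ideal.span {a} * I := by
        rw [← hI, pow_two]
        exact Ideal.mul_mem_mul hi hj
      obtain ⟨k, hk, hak⟩ := Ideal.mem_span_singleton_mul.mp hij
      have hak' := congrArg (algebraMap R (FractionRing R)) hak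
      simp only [map_mul] at hak'
      have : y * b * algebraMap R (FractionRing R) i * Algebra.linearMap R (FractionRing R) j
          = y * algebraMap R (FractionRing R) k := by
        rw [Algebra.linearMap_apply]
        linear_combination (-y * b) * hak' + y * algebraMap R (FractionRing R) k * hb
      rw [this]
      exact hy _ ⟨k, hk, rfl⟩
    have := hα _ hyi
    rwa [Algebra.linearMap_apply, show α * b * y * algebraMap R (FractionRing R) i
      = α * (y * b * algebraMap R (FractionRing R) i) by ring]
  have one_mem : (1 : FractionRing R) ∈ 1 / idealImage I := by
    rintro _ ⟨i, -, rfl⟩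
    exact Submodule.mem_one.mpr ⟨i, by simp⟩
  have pow_mem : ∀ n : ℕ, (α * b) ^ n ∈ 1 / idealImage I := fun n ↦ by
    induction n with
    | zero => simpa using one_mem
    | succ n ih => rw [pow_succ']; exact step _ ih
  refine ⟨a, ha, fun n ↦ ?_⟩
  obtain ⟨r, hr⟩ := Submodule.mem_one.mp (pow_mem n _ ⟨a, haI, rfl⟩)
  exact ⟨r, by rw [hr, Algebra.smul_def, mul_comm, Algebra.linearMap_apply]⟩

/-- If `x / a` is integral over `R` and `a ∈ I`, then `x` is integral over `I`. -/
theorem isIntegralOverIdeal_of_isIntegral_mul {R S : Type*} [CommRing R] [CommRing S]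
    [Algebra R S] (hinj : Function.Injective (algebraMap R S)) {I : Ideal R} {a x : R}
    (haI : a ∈ I) {b : S} (hb : algebraMap R S a * b = 1)
    (h : IsIntegral R (algebraMap R S x * b)) : IsIntegralOverIdeal I x := by
  cases subsingleton_or_nontrivial R
  · exact ⟨1, one_pos, 0, fun i _ _ ↦ zero_mem _, Subsingleton.elim _ _⟩
  obtain ⟨p, hp, hpx⟩ := h
  -- multiplying by `X` makes the degree positive
  have hq : (p * Polynomial.X).Monic := hp.mul Polynomial.monic_X
  have hqx : Polynomial.aeval (algebraMap R S x * b) (p * Polynomial.X) = 0 := by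
    rw [map_mul, Polynomial.aeval_def, hpx, zero_mul]
  have hpos : 0 < (p * Polynomial.X).natDegree := by
    rw [hp.natDegree_mul Polynomial.monic_X, Polynomial.natDegree_X]
    lia
  generalize p * Polynomial.X = q at hq hqx hpos
  refine ⟨q.natDegree, hpos, fun i ↦ q.coeff (q.natDegree - i) * a ^ i,
    fun i _ _ ↦ Ideal.mul_mem_left _ _ (Ideal.pow_mem_pow haI i), hinj ?_⟩
  set n := q.natDegree
  have key : ∑ i ∈ Finset.range (n + 1), q.coeff (n - i) * a ^ i * x ^ (n - i)
      = x ^ n + ∑ i ∈ Finset.Icc 1 n, q.coeff (n - i) * a ^ i * x ^ (n - i) := by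
    rw [Finset.range_eq_Ico, Finset.sum_eq_sum_Ico_succ_bot (by lia)]
    have : q.coeff n = 1 := hq
    simp only [Nat.sub_zero, this, pow_zero, one_mul]
    rfl
  rw [← key, map_zero, map_sum]
  have hab : ∀ i, algebraMap R S a ^ i * b ^ i = 1 := fun i ↦ by rw [← mul_pow, hb, one_pow]
  rw [Polynomial.aeval_eq_sum_range, ← Finset.sum_range_reflect] at hqx
  have := congrArg (algebraMap R S a ^ n * ·) hqx
  simp only [mul_zero, Finset.mul_sum] at this
  rw [← this]
  refine Finset.sum_congr rfl fun i hi ↦ ?_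
  have hin : i ≤ n := by simpa [Nat.lt_succ_iff] using hi
  rw [show n + 1 - 1 - i = n - i by lia, Algebra.smul_def, mul_pow]
  have hsplit : algebraMap R S a ^ n = algebraMap R S a ^ i * algebraMap R S a ^ (n - i) := by
    rw [← pow_add, Nat.add_sub_cancel' hin]
  simp only [map_mul, map_pow]
  rw [hsplit]
  linear_combination (-algebraMap R S (q.coeff (n - i)) * algebraMap R S a ^ i *
    algebraMap R S x ^ (n - i)) * hab (n - i)

open scoped nonZeroDivisors in
theorem idealImage_eq_one_div_one_div {R : Type*} [CommRing R] [IsNoetherianRing R]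
    {I : Ideal R} (hcl : IsIntegrallyClosedIdeal I) {a : R} (haI : a ∈ I) (ha : a ∈ R⁰)
    (hI : I ^ 2 = Ideal.span {a} * I) : idealImage I = 1 / (1 / idealImage I) := by
  refine le_antisymm (fun z hz y hy ↦ mul_comm y z ▸ hy z hz) fun α hα ↦ ?_
  obtain ⟨b, hb⟩ := (IsLocalization.map_units (FractionRing R) (⟨a, ha⟩ : R⁰)).exists_right_inv
  have hone : (1 : FractionRing R) ∈ 1 / idealImage I := by
    rintro _ ⟨i, -, rfl⟩
    exact Submodule.mem_one.mpr ⟨i, by simp⟩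
  obtain ⟨x, hx⟩ := Submodule.mem_one.mp (hα 1 hone)
  rw [mul_one] at hx
  subst hx
  have hint := (isAlmostIntegral_mul_of_mem_one_div_one_div haI ha hI hb
    hα).isIntegral_of_nonZeroDivisors_le_comap fun r hr ↦
      (IsLocalization.map_units (FractionRing R) (⟨r, hr⟩ : R⁰)).mem_nonZeroDivisors
  exact ⟨x, hcl x (isIntegralOverIdeal_of_isIntegral_mul
    (IsFractionRing.injective R (FractionRing R)) haI hb hint), rfl⟩

open scoped nonZeroDivisors in
/-- An ideal containing a nonzerodivisor which equals its double colon in the total ring of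
fractions is a reflexive module. -/
theorem isReflexive_of_one_div_one_div_le {R : Type*} [CommRing R] {I : Ideal R} {x : R}
    (hxI : x ∈ I) (hx : x ∈ R⁰) (h : 1 / (1 / idealImage I) ≤ idealImage I) :
    Module.IsReflexive R I := by
  have hcomm : ∀ (f : Module.Dual R I) (i j : I), (i : R) * f j = j * f i := fun f i j ↦ by
    rw [← smul_eq_mul, ← map_smul, ← smul_eq_mul, ← map_smul]
    congr 1
    exact Subtype.ext (mul_comm _ _)
  have hcancel : ∀ {r s : R}, x * r = x * s → r = s := fun hrs ↦
    (mul_cancel_left_mem_nonZeroDivisors hx).mp hrs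
  refine ⟨⟨fun i j hij ↦ Subtype.ext (LinearMap.congr_fun hij I.subtype), fun φ ↦ ?_⟩⟩
  have hφ : ∀ f : Module.Dual R I, x * φ f = f ⟨x, hxI⟩ * φ I.subtype := fun f ↦ by
    rw [← smul_eq_mul, ← map_smul, ← smul_eq_mul, ← map_smul]
    congr 1
    ext i
    simpa [mul_comm] using hcomm f ⟨x, hxI⟩ i
  have hinj := IsFractionRing.injective R (FractionRing R)
  have hmem : algebraMap R (FractionRing R) (φ I.subtype) ∈ 1 / (1 / idealImage I) := by
    intro y hy
    have hy' : ∀ i : I, ∃ r : R, algebraMap R (FractionRing R) r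
        = y * algebraMap R (FractionRing R) i := fun i ↦ Submodule.mem_one.mp (hy _ ⟨i, i.2, rfl⟩)
    choose f hf using hy'
    let F : Module.Dual R I :=
      { toFun := f
        map_add' := fun i j ↦ hinj (by simp [hf, mul_add])
        map_smul' := fun r i ↦ hinj (by simp [hf, mul_left_comm]) }
    refine Submodule.mem_one.mpr ⟨φ F, ?_⟩
    have hF := congrArg (algebraMap R (FractionRing R)) (hφ F)
    rw [map_mul, map_mul, show F ⟨x, hxI⟩ = f ⟨x, hxI⟩ from rfl, hf] at hF
    refine (IsLocalization.map_units (FractionRing R) (⟨x, hx⟩ : R⁰)).mul_left_cancel ?_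
    linear_combination hF
  obtain ⟨α, hαI, hα⟩ := h hmem
  have hα' : α = φ I.subtype := hinj hα
  refine ⟨⟨α, hαI⟩, LinearMap.ext fun f ↦ hcancel ?_⟩
  rw [Module.Dual.eval_apply, hφ, hcomm f ⟨x, hxI⟩ ⟨α, hαI⟩, ← hα', mul_comm]

/-- Let `R` be a one-dimensional Cohen-Macaulay semi-local Arf ring and `I` an integrally
closed ideal of `R` containing a nonzerodivisor. Then `I = R : (R : I)` (inside `Q(R)`);
in particular, `I` is a reflexive `R`-module. -/
theorem integrally_closed_is_reflexive {R : Type} [CommRing R]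
    (hR : IsOneDimCMSemiLocal R) (hArf : IsArfRing R) (I : Ideal R)
    (hcl : IsIntegrallyClosedIdeal I) (hnzd : ∃ x ∈ I, x ∈ nonZeroDivisors R) :
    idealImage I = 1 / (1 / idealImage I) ∧ Module.IsReflexive R ↥I := by
  have := hR.1
  obtain ⟨a, haI, hI⟩ := hArf I hcl hnzd
  obtain ⟨x, hxI, hx⟩ := hnzd
  have hxx : x * x ∈ Ideal.span {a} * I := by
    rw [← hI, pow_two]
    exact Ideal.mul_mem_mul hxI hxI
  obtain ⟨k, -, hk⟩ := Ideal.mem_span_singleton_mul.mp hxx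
  have ha : a ∈ nonZeroDivisors R :=
    (mul_mem_nonZeroDivisors.mp (hk ▸ mul_mem hx hx : a * k ∈ nonZeroDivisors R)).1
  have heq := idealImage_eq_one_div_one_div hcl haI ha hI
  exact ⟨heq, isReflexive_of_one_div_one_div_le hxI hx heq.ge⟩
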